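/- Let R be a commutative ring, A the forcing algebra with several forcing equations given by an m×n matrix (f_{ij}) and vector (f_1,...,f_m) over R. For a prime ideal p of R, let r be the rank of the matrix (f_{ij}(p)) over the residue field κ(p). Then the fiber ring κ(p) ⊗_R A is either the zero ring or isomorphic to a polynomial ring over κ(p) in n − r variables. -/

import Mathlib

open MvPolynomial
open scoped Matrix

section GeneralizedInverse

variable {K : Type*} [Field K]

theorem Matrix.exists_mul_mul_self {m n : ℕ} (F : Matrix (Fin m) (Fin n) K) :
    ∃ G : Matrix (Fin n) (Fin m) K, F * G * F = F := by
  obtain ⟨s, hs⟩ := F.mulVecLin.rangeRestrict.exists_rightInverse_of_surjective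
    F.mulVecLin.range_rangeRestrict
  obtain ⟨g, hg⟩ := s.exists_extend
  refine ⟨LinearMap.toMatrix' g, Matrix.mulVec_injective (funext fun v => ?_)⟩
  have h₁ : g (F *ᵥ v) = s (F.mulVecLin.rangeRestrict v) :=
    LinearMap.congr_fun hg (F.mulVecLin.rangeRestrict v)
  have h₂ := congrArg Subtype.val (LinearMap.congr_fun hs (F.mulVecLin.rangeRestrict v))
  rw [← Matrix.mulVec_mulVec, ← Matrix.mulVec_mulVec, LinearMap.toMatrix'_mulVec, h₁]
  exact h₂

/-- A matrix of a basis of the kernel of `F`, a left inverse of it, and a generalized inverse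
of `F` that splits off the kernel. -/
theorem Matrix.exists_kernel_splitting {m n : ℕ} (F : Matrix (Fin m) (Fin n) K) :
    ∃ (B : Matrix (Fin n) (Fin (n - F.rank)) K) (P : Matrix (Fin (n - F.rank)) (Fin n) K)
      (G : Matrix (Fin n) (Fin m) K),
      F * B = 0 ∧ P * B = 1 ∧ B * P = 1 - G * F ∧ F * G * F = F := by
  obtain ⟨G, hG⟩ := F.exists_mul_mul_self
  have hdim : Module.finrank K (LinearMap.ker F.mulVecLin) = n - F.rank := by
    have := F.mulVecLin.finrank_range_add_finrank_ker
    rw [Module.finrank_fin_fun] at this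
    rw [Matrix.rank]
    omega
  let e := (Module.finBasisOfFinrankEq K _ hdim).equivFun
  let π : (Fin n → K) →ₗ[K] LinearMap.ker F.mulVecLin :=
    (1 - G * F).mulVecLin.codRestrict _ fun v => by
      change F *ᵥ (1 - G * F) *ᵥ v = 0
      rw [Matrix.mulVec_mulVec, Matrix.mul_sub, ← Matrix.mul_assoc, hG, Matrix.mul_one, sub_self,
        Matrix.zero_mulVec]
  let b := (LinearMap.ker F.mulVecLin).subtype ∘ₗ e.symm.toLinearMap
  let ρ := e.toLinearMap ∘ₗ π
  have hFb (v) : F *ᵥ b v = 0 := (e.symm v).2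
  refine ⟨LinearMap.toMatrix' b, LinearMap.toMatrix' ρ, G, ?_, ?_, ?_, hG⟩
  · refine Matrix.mulVec_injective (funext fun v => ?_)
    simp only [← Matrix.mulVec_mulVec, LinearMap.toMatrix'_mulVec, hFb, Matrix.zero_mulVec]
  · refine Matrix.mulVec_injective (funext fun v => ?_)
    simp only [← Matrix.mulVec_mulVec, LinearMap.toMatrix'_mulVec, Matrix.one_mulVec]
    have : π (b v) = e.symm v := by
      apply Subtype.ext
      change (1 - G * F) *ᵥ b v = b v
      simp [Matrix.sub_mulVec, ← Matrix.mulVec_mulVec, hFb]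
    simp [ρ, this]
  · refine Matrix.mulVec_injective (funext fun v => ?_)
    simp only [← Matrix.mulVec_mulVec, LinearMap.toMatrix'_mulVec]
    simp [ρ, b, π, Matrix.sub_mulVec]

end GeneralizedInverse

section ForcingAlgebra

theorem Ideal.mulVec_mem {S m n : Type*} [CommRing S] [Fintype n] (I : Ideal S)
    (M : Matrix m n S) {v : n → S} (hv : ∀ j, v j ∈ I) (i : m) : (M *ᵥ v) i ∈ I :=
  I.sum_mem fun j _ => I.mul_mem_left _ (hv j)

variable {K : Type*} [Field K]

/-- The forcing equations `F T + g`. -/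
noncomputable def forcingEquations {R : Type*} [CommRing R] {m n : ℕ}
    (F : Matrix (Fin m) (Fin n) R) (g : Fin m → R) : Fin m → MvPolynomial (Fin n) R :=
  F.map C *ᵥ X + C ∘ g

theorem subsingleton_quotient_forcingEquations {m n : ℕ} {F : Matrix (Fin m) (Fin n) K}
    {g : Fin m → K} {G : Matrix (Fin n) (Fin m) K} (hG : F * G * F = F)
    (hg : F *ᵥ (G *ᵥ g) ≠ g) :
    Subsingleton (MvPolynomial (Fin n) K ⧸ Ideal.span (Set.range (forcingEquations F g))) := by
  obtain ⟨i, hi⟩ := Function.ne_iff.mp hg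
  have hcomb : ((1 - F * G).map C) *ᵥ forcingEquations F g =
      (C ∘ (g - F *ᵥ (G *ᵥ g)) : Fin m → MvPolynomial (Fin n) K) := by
    have h : (1 - F * G).map (C (σ := Fin n)) *ᵥ (C ∘ g) = C ∘ ((1 - F * G) *ᵥ g) :=
      funext fun j => ((C (σ := Fin n)).map_mulVec _ _ j).symm
    rw [forcingEquations, Matrix.mulVec_add, Matrix.mulVec_mulVec, ← Matrix.map_mul, h,
      Matrix.sub_mul, hG]
    simp [Matrix.sub_mulVec]
  have hmem := Ideal.mulVec_mem _ ((1 - F * G).map (C (σ := Fin n)))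
    (fun j => Ideal.subset_span (Set.mem_range_self (f := forcingEquations F g) j)) i
  rw [hcomb] at hmem
  refine Ideal.Quotient.subsingleton_iff.mpr (Ideal.eq_top_of_isUnit_mem _ hmem ?_)
  exact (IsUnit.mk0 _ (sub_ne_zero.mpr (Ne.symm hi))).map C

theorem nonempty_quotient_forcingEquations_algEquiv {m n k : ℕ} {F : Matrix (Fin m) (Fin n) K}
    {g : Fin m → K} {B : Matrix (Fin n) (Fin k) K} {P : Matrix (Fin k) (Fin n) K}
    {G : Matrix (Fin n) (Fin m) K} (hFB : F * B = 0) (hPB : P * B = 1) (hBP : B * P = 1 - G * F)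
    {t : Fin n → K} (ht : F *ᵥ t + g = 0) :
    Nonempty ((MvPolynomial (Fin n) K ⧸ Ideal.span (Set.range (forcingEquations F g))) ≃ₐ[K]
      MvPolynomial (Fin k) K) := by
  set I := Ideal.span (Set.range (forcingEquations F g))
  have hmap {a b c : ℕ} (M : Matrix (Fin a) (Fin b) K) (v : Fin b → K) :
      M.map (C (σ := Fin c)) *ᵥ (C ∘ v) = C ∘ (M *ᵥ v) :=
    funext fun j => ((C (σ := Fin c)).map_mulVec _ _ j).symm
  have hcomp {a b c : ℕ} {S : Type _} [CommRing S] [Algebra K S]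
      (f : MvPolynomial (Fin c) K →ₐ[K] S) (M : Matrix (Fin a) (Fin b) K)
      (v : Fin b → MvPolynomial (Fin c) K) (i : Fin a) :
      f ((M.map C *ᵥ v) i) = (M.map (algebraMap K S) *ᵥ (f ∘ v)) i := by
    have hM : (M.map C).map f = M.map (algebraMap K S) := by
      ext
      simp
    exact (f.toRingHom.map_mulVec _ _ i).trans (congrFun (congrArg (· *ᵥ (f ∘ v)) hM) i)
  let φ₀ : MvPolynomial (Fin n) K →ₐ[K] MvPolynomial (Fin k) K :=
    aeval (C ∘ t + B.map C *ᵥ X)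
  have hφX : φ₀ ∘ X = C ∘ t + B.map C *ᵥ X := funext fun j => aeval_X _ j
  have hφC {a : ℕ} (v : Fin a → K) : φ₀ ∘ C ∘ v = C ∘ v := funext fun j => aeval_C _ _
  have hφ₀ (x) (hx : x ∈ I) : φ₀ x = 0 := by
    suffices I ≤ RingHom.ker φ₀ from this hx
    refine Ideal.span_le.mpr ?_
    rintro _ ⟨i, rfl⟩
    have hi := congrFun ht i
    simp only [Pi.add_apply, Pi.zero_apply] at hi
    change φ₀ (forcingEquations F g i) = 0
    rw [forcingEquations, Pi.add_apply, map_add, hcomp, hφX]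
    simp only [algebraMap_eq, Matrix.mulVec_add, hmap, Matrix.mulVec_mulVec,
      ← Matrix.map_mul, hFB, Matrix.map_zero _ C_0, Matrix.zero_mulVec, add_zero, Function.comp_apply]
    rw [show φ₀ (C (g i)) = C (g i) from aeval_C _ _, ← C_add, hi, C_0]
  let y : Fin n → MvPolynomial (Fin n) K := X - C ∘ t
  let φ := Ideal.Quotient.liftₐ I φ₀ hφ₀
  let ψ : MvPolynomial (Fin k) K →ₐ[K] MvPolynomial (Fin n) K ⧸ I :=
    aeval fun l => Ideal.Quotient.mkₐ K I ((P.map C *ᵥ y) l)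
  have hy : F.map C *ᵥ y = forcingEquations F g := by
    have : F *ᵥ t = -g := eq_neg_of_add_eq_zero_left ht
    rw [forcingEquations, Matrix.mulVec_sub, hmap, this]
    ext1 i
    simp
  refine ⟨AlgEquiv.ofAlgHom φ ψ ?_ ?_⟩
  · refine algHom_ext fun l => ?_
    have hφy : φ₀ ∘ y = B.map C *ᵥ X := by
      ext1 j
      have := congrFun hφX j
      simp only [Function.comp_apply, Pi.add_apply] at this
      simp [y, this, show φ₀ (C (t j)) = C (t j) from aeval_C _ _]
    have : φ (ψ (X l)) = φ₀ ((P.map C *ᵥ y) l) := by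
      simp only [ψ, aeval_X]
      rfl
    rw [AlgHom.comp_apply, this, hcomp, hφy, algebraMap_eq, Matrix.mulVec_mulVec,
      ← Matrix.map_mul, hPB, Matrix.map_one _ C_0 C_1, Matrix.one_mulVec, AlgHom.id_apply]
  · refine Ideal.Quotient.algHom_ext _ (algHom_ext fun j => ?_)
    have hψX : ψ ∘ X = Ideal.Quotient.mkₐ K I ∘ (P.map C *ᵥ y) := funext fun l => aeval_X _ l
    have hφ : φ (Ideal.Quotient.mkₐ K I (X j)) = (C ∘ t + B.map C *ᵥ X : Fin n → _) j :=
      congrFun hφX j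
    have hmem : (G.map C *ᵥ forcingEquations F g) j ∈ I :=
      I.mulVec_mem _ (fun i => Ideal.subset_span (Set.mem_range_self i)) j
    change ψ (φ (Ideal.Quotient.mkₐ K I (X j))) = Ideal.Quotient.mkₐ K I (X j)
    rw [hφ, Pi.add_apply, map_add, hcomp, hψX, ← hcomp, Matrix.mulVec_mulVec,
      ← Matrix.map_mul, hBP, Matrix.map_sub _ (map_sub C), Matrix.map_one _ C_0 C_1,
      Matrix.map_mul, Matrix.sub_mulVec, Matrix.one_mulVec, ← Matrix.mulVec_mulVec, hy]
    have hC : ψ (C (t j)) = Ideal.Quotient.mkₐ K I (C (t j)) :=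
      (ψ.commutes _).trans ((Ideal.Quotient.mkₐ K I).commutes _).symm
    rw [Function.comp_apply, hC, ← map_add]
    refine Ideal.Quotient.eq.mpr ?_
    convert I.neg_mem hmem using 1
    simp only [y, Pi.sub_apply, Function.comp_apply]
    ring

/-- Base change of a forcing algebra. -/
noncomputable def tensorQuotientForcingEquationsEquiv {R : Type*} [CommRing R] (S : Type*)
    [CommRing S] [Algebra R S] {m n : ℕ} (F : Matrix (Fin m) (Fin n) R) (g : Fin m → R) :
    TensorProduct R S
        (MvPolynomial (Fin n) R ⧸ Ideal.span (Set.range (forcingEquations F g))) ≃ₐ[S]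
      MvPolynomial (Fin n) S ⧸ Ideal.span (Set.range
        (forcingEquations (F.map (algebraMap R S)) (algebraMap R S ∘ g))) :=
  (Algebra.TensorProduct.tensorQuotientEquiv S _ S _).trans <|
    Ideal.quotientEquivAlg _ _ (algebraTensorAlgEquiv R S) <| by
      rw [Ideal.map_span, Ideal.map_span, ← Set.range_comp, ← Set.range_comp]
      congr 2
      ext1 i
      simp [forcingEquations, Matrix.mulVec, dotProduct]

end ForcingAlgebra

theorem forcing_algebra_fiber_affine_space {R : Type*} [CommRing R] (m n : ℕ)
    (F : Matrix (Fin m) (Fin n) R) (g : Fin m → R)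
    (h : Fin m → MvPolynomial (Fin n) R)
    (hh : ∀ i, h i = ∑ j, C (F i j) * X j + C (g i))
    (p : Ideal R) [p.IsPrime] :
    Subsingleton (TensorProduct R (IsLocalRing.ResidueField (Localization.AtPrime p))
        (MvPolynomial (Fin n) R ⧸ Ideal.span (Set.range h))) ∨
    Nonempty (TensorProduct R (IsLocalRing.ResidueField (Localization.AtPrime p))
        (MvPolynomial (Fin n) R ⧸ Ideal.span (Set.range h)) ≃ₐ[IsLocalRing.ResidueField (Localization.AtPrime p)]
      MvPolynomial
        (Fin (n - (F.map (algebraMap R (IsLocalRing.ResidueField (Localization.AtPrime p)))).rank))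
        (IsLocalRing.ResidueField (Localization.AtPrime p))) := by
  obtain rfl : h = forcingEquations F g :=
    funext fun i => by simp [hh, forcingEquations, Matrix.mulVec, dotProduct]
  let e := tensorQuotientForcingEquationsEquiv
    (IsLocalRing.ResidueField (Localization.AtPrime p)) F g
  obtain ⟨B, P, G, hFB, hPB, hBP, hG⟩ := Matrix.exists_kernel_splitting
    (F.map (algebraMap R (IsLocalRing.ResidueField (Localization.AtPrime p))))
  by_cases hg : F.map (algebraMap R (IsLocalRing.ResidueField (Localization.AtPrime p))) *ᵥ
      (G *ᵥ (algebraMap R _ ∘ g)) = algebraMap R _ ∘ g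
  · obtain ⟨e'⟩ := nonempty_quotient_forcingEquations_algEquiv (t := -(G *ᵥ (algebraMap R _ ∘ g)))
      hFB hPB hBP (by rw [Matrix.mulVec_neg, hg, neg_add_cancel])
    exact Or.inr ⟨e.trans e'⟩
  · have := subsingleton_quotient_forcingEquations hG hg
    exact Or.inl e.toEquiv.subsingleton
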